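/- Let T > 0, let λ : [0,1]×[0,1] → ℝ be continuous and strictly positive, and let ψ : [0,T]×[0,1] → ℝ be nonnegative, continuous, with continuous partial derivative ∂_sψ in the time variable. For H ∈ C([0,T]×[0,1],ℝ) define ϑ(H) = ∫₀ᵀ∫₀¹ ∂_sψ(s,x) H(s,x) dx ds − ∫₀ᵀ∫₀¹∫₀¹ ψ(s,x) λ(x,y) ( e^{H(s,y)−H(s,x)} − 1 ) dy dx ds. Suppose G ∈ C([0,T]×[0,1],ℝ) satisfies, for all s ∈ [0,T] and x ∈ [0,1], ∂_sψ(s,x) = ∫₀¹ [ ψ(s,y) λ(y,x) e^{G(s,x)−G(s,y)} − ψ(s,x) λ(x,y) e^{G(s,y)−G(s,x)} ] dy. Then ϑ(H) ≤ ϑ(G) for every H ∈ C([0,T]×[0,1],ℝ); that is, ϑ(G) = sup_{H ∈ C([0,T]×[0,1],ℝ)} ϑ(H). -/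

import Mathlib

open MeasureTheory Set Real

section CompactParameter

variable {X : Type*} [TopologicalSpace X] [CompactSpace X]
  [MeasurableSpace X] [OpensMeasurableSpace X]

/-- A continuous real function on a compact space is integrable for any finite measure. -/
lemma Continuous.integrable_of_compactSpace {μ : Measure X} [IsFiniteMeasure μ] {f : X → ℝ}
    (hf : Continuous f) : Integrable f μ :=
  hf.integrable_of_hasCompactSupport (HasCompactSupport.of_compactSpace f)

/-- Integrating out a variable in a compact space preserves continuity on a set of parameters. -/
lemma ContinuousOn.integral_prod_right_of_compactSpace {P : Type*} [TopologicalSpace P]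
    {μ : Measure X} [IsFiniteMeasure μ] {A : Set P} {f : P → X → ℝ}
    (hf : ContinuousOn (Function.uncurry f) (A ×ˢ univ)) :
    ContinuousOn (fun p => ∫ x, f p x ∂μ) A := by
  simpa using continuousOn_integral_of_compact_support (μ := μ) (s := A) (k := univ)
    isCompact_univ hf (fun p x _ hx => absurd (mem_univ x) hx)

/-- At a fixed time, the tilt `g` producing the net flux `v` maximizes the associated
exponential functional. -/
lemma integral_mul_sub_exp_le_of_tilt [SecondCountableTopology X]
    {μ : Measure X} [IsFiniteMeasure μ]
    {lam : X × X → ℝ} (hlam : Continuous lam) (hlam_nonneg : ∀ p, 0 ≤ lam p)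
    {u v g h : X → ℝ} (hu : Continuous u) (hu_nonneg : ∀ x, 0 ≤ u x) (hv : Continuous v)
    (hg : Continuous g) (hh : Continuous h)
    (hvg : ∀ x, v x = ∫ y, (u y * lam (y, x) * exp (g x - g y)
      - u x * lam (x, y) * exp (g y - g x)) ∂μ) :
    (∫ x, v x * h x ∂μ) - (∫ x, ∫ y, u x * lam (x, y) * (exp (h y - h x) - 1) ∂μ ∂μ)
      ≤ (∫ x, v x * g x ∂μ) - (∫ x, ∫ y, u x * lam (x, y) * (exp (g y - g x) - 1) ∂μ ∂μ) := by
  set k : X × X → ℝ := fun p => u p.1 * lam p * exp (g p.2 - g p.1) with hk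
  have hkc : Continuous k := by fun_prop
  have prod_eq (F : X × X → ℝ) (hF : Continuous F) :
      ∫ x, ∫ y, F (x, y) ∂μ ∂μ = ∫ p, F p ∂(μ.prod μ) :=
    (integral_prod F hF.integrable_of_compactSpace).symm
  have flux : (∫ x, v x * h x ∂μ) - (∫ x, v x * g x ∂μ)
      = ∫ p, k p * ((h p.2 - g p.2) - (h p.1 - g p.1)) ∂(μ.prod μ) := by
    have e1 : (∫ x, v x * h x ∂μ) - (∫ x, v x * g x ∂μ)
        = ∫ x, ∫ y, (k (y, x) - k (x, y)) * (h x - g x) ∂μ ∂μ := by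
      rw [← integral_sub (Continuous.integrable_of_compactSpace (by fun_prop))
        (Continuous.integrable_of_compactSpace (by fun_prop))]
      refine integral_congr_ae (.of_forall fun x => ?_)
      simp only [integral_mul_const]
      rw [← mul_sub, hvg x]
    have e2 := prod_eq (fun p => (k p.swap - k p) * (h p.1 - g p.1)) (by fun_prop)
    have e3 : ∫ p, k p.swap * (h p.1 - g p.1) ∂(μ.prod μ)
        = ∫ p, k p * (h p.2 - g p.2) ∂(μ.prod μ) :=
      integral_prod_swap (μ := μ) (ν := μ) (fun p : X × X => k p * (h p.2 - g p.2))
    rw [e1]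
    refine e2.trans ?_
    simp only [sub_mul, mul_sub (k _) (_ - _) (_ - _)]
    rw [integral_sub (Continuous.integrable_of_compactSpace (by fun_prop))
      (Continuous.integrable_of_compactSpace (by fun_prop)),
      integral_sub (Continuous.integrable_of_compactSpace (by fun_prop))
      (Continuous.integrable_of_compactSpace (by fun_prop)), e3]
  have eh := prod_eq (fun p => u p.1 * lam p * (exp (h p.2 - h p.1) - 1)) (by fun_prop)
  have eg := prod_eq (fun p => u p.1 * lam p * (exp (g p.2 - g p.1) - 1)) (by fun_prop)
  have entropy : ∫ p, k p * ((h p.2 - g p.2) - (h p.1 - g p.1)) ∂(μ.prod μ)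
      ≤ (∫ p, u p.1 * lam p * (exp (h p.2 - h p.1) - 1) ∂(μ.prod μ))
        - ∫ p, u p.1 * lam p * (exp (g p.2 - g p.1) - 1) ∂(μ.prod μ) := by
    rw [← integral_sub (Continuous.integrable_of_compactSpace (by fun_prop))
      (Continuous.integrable_of_compactSpace (by fun_prop))]
    refine integral_mono (Continuous.integrable_of_compactSpace (by fun_prop))
      (Continuous.integrable_of_compactSpace (by fun_prop)) fun p => ?_
    have hk0 : 0 ≤ k p :=
      mul_nonneg (mul_nonneg (hu_nonneg _) (hlam_nonneg _)) (exp_pos _).le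
    have hexp := add_one_le_exp ((h p.2 - g p.2) - (h p.1 - g p.1))
    have hmul : exp (h p.2 - h p.1)
        = exp (g p.2 - g p.1) * exp ((h p.2 - g p.2) - (h p.1 - g p.1)) := by
      rw [← exp_add]; ring_nf
    calc k p * ((h p.2 - g p.2) - (h p.1 - g p.1))
        ≤ k p * (exp ((h p.2 - g p.2) - (h p.1 - g p.1)) - 1) :=
          mul_le_mul_of_nonneg_left (by linarith) hk0
      _ = _ := by simp only [hk, hmul]; ring
  linarith

end CompactParameter

/-- The tilt `G` solving the tilted hydrodynamic equation maximizes the dynamical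
large-deviation functional `ϑ` over all continuous `H` on `[0,T]×[0,1]`. -/
theorem tilt_maximizes_dynamical_functional
    (T : ℝ) (hT : 0 < T)
    (lam : (Set.Icc (0:ℝ) 1) × (Set.Icc (0:ℝ) 1) → ℝ)
    (hlam_cont : Continuous lam) (hlam_pos : ∀ p, 0 < lam p)
    (ψ ψ' : ℝ × Set.Icc (0:ℝ) 1 → ℝ)
    (hψ_nonneg : ∀ s ∈ Set.Icc (0:ℝ) T, ∀ x : Set.Icc (0:ℝ) 1, 0 ≤ ψ (s, x))
    (hψ_cont : ContinuousOn ψ (Set.Icc (0:ℝ) T ×ˢ Set.univ))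
    (hψ'_cont : ContinuousOn ψ' (Set.Icc (0:ℝ) T ×ˢ Set.univ))
    (hψ_deriv : ∀ (x : Set.Icc (0:ℝ) 1), ∀ s ∈ Set.Icc (0:ℝ) T,
      HasDerivWithinAt (fun s => ψ (s, x)) (ψ' (s, x)) (Set.Icc (0:ℝ) T) s)
    (G : ℝ × Set.Icc (0:ℝ) 1 → ℝ)
    (hG_cont : ContinuousOn G (Set.Icc (0:ℝ) T ×ˢ Set.univ))
    (hG_eq : ∀ s ∈ Set.Icc (0:ℝ) T, ∀ x : Set.Icc (0:ℝ) 1,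
      ψ' (s, x) = ∫ y : Set.Icc (0:ℝ) 1,
        (ψ (s, y) * lam (y, x) * exp (G (s, x) - G (s, y))
          - ψ (s, x) * lam (x, y) * exp (G (s, y) - G (s, x)))) :
    ∀ H : ℝ × Set.Icc (0:ℝ) 1 → ℝ, ContinuousOn H (Set.Icc (0:ℝ) T ×ˢ Set.univ) →
      (∫ s in (0:ℝ)..T, ∫ x : Set.Icc (0:ℝ) 1, ψ' (s, x) * H (s, x))
          - (∫ s in (0:ℝ)..T, ∫ x : Set.Icc (0:ℝ) 1, ∫ y : Set.Icc (0:ℝ) 1,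
              ψ (s, x) * lam (x, y) * (exp (H (s, y) - H (s, x)) - 1))
        ≤ (∫ s in (0:ℝ)..T, ∫ x : Set.Icc (0:ℝ) 1, ψ' (s, x) * G (s, x))
          - (∫ s in (0:ℝ)..T, ∫ x : Set.Icc (0:ℝ) 1, ∫ y : Set.Icc (0:ℝ) 1,
              ψ (s, x) * lam (x, y) * (exp (G (s, y) - G (s, x)) - 1)) := by
  have slice {F : ℝ × Set.Icc (0:ℝ) 1 → ℝ} (hF : ContinuousOn F (Set.Icc (0:ℝ) T ×ˢ Set.univ))
      {s : ℝ} (hs : s ∈ Set.Icc (0:ℝ) T) : Continuous fun x => F (s, x) :=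
    hF.comp_continuous (by fun_prop) fun x => ⟨hs, mem_univ x⟩
  have linear_cont (K : ℝ × Set.Icc (0:ℝ) 1 → ℝ)
      (hK : ContinuousOn K (Set.Icc (0:ℝ) T ×ˢ Set.univ)) :
      IntervalIntegrable (fun s => ∫ x : Set.Icc (0:ℝ) 1, ψ' (s, x) * K (s, x)) volume 0 T :=
    ContinuousOn.intervalIntegrable_of_Icc hT.le
      (ContinuousOn.integral_prod_right_of_compactSpace (hψ'_cont.mul hK))
  have exp_cont (K : ℝ × Set.Icc (0:ℝ) 1 → ℝ)
      (hK : ContinuousOn K (Set.Icc (0:ℝ) T ×ˢ Set.univ)) :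
      IntervalIntegrable (fun s => ∫ x : Set.Icc (0:ℝ) 1, ∫ y : Set.Icc (0:ℝ) 1,
        ψ (s, x) * lam (x, y) * (exp (K (s, y) - K (s, x)) - 1)) volume 0 T := by
    refine ContinuousOn.intervalIntegrable_of_Icc hT.le
      (ContinuousOn.integral_prod_right_of_compactSpace ?_)
    refine ContinuousOn.integral_prod_right_of_compactSpace
      (f := fun (p : ℝ × Set.Icc (0:ℝ) 1) y =>
        ψ (p.1, p.2) * lam (p.2, y) * (exp (K (p.1, y) - K (p.1, p.2)) - 1)) ?_
    have fst_cont {F : ℝ × Set.Icc (0:ℝ) 1 → ℝ}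
        (hF : ContinuousOn F (Set.Icc (0:ℝ) T ×ˢ Set.univ)) :
        ContinuousOn (fun q : (ℝ × Set.Icc (0:ℝ) 1) × Set.Icc (0:ℝ) 1 => F (q.1.1, q.1.2))
          ((Set.Icc (0:ℝ) T ×ˢ Set.univ) ×ˢ Set.univ) :=
      hF.comp (by fun_prop) fun q hq => hq.1
    have snd_cont : ContinuousOn
        (fun q : (ℝ × Set.Icc (0:ℝ) 1) × Set.Icc (0:ℝ) 1 => K (q.1.1, q.2))
        ((Set.Icc (0:ℝ) T ×ˢ Set.univ) ×ˢ Set.univ) :=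
      hK.comp (by fun_prop) fun q hq => ⟨hq.1.1, hq.2⟩
    exact ((fst_cont hψ_cont).mul (by fun_prop)).mul
      ((snd_cont.sub (fst_cont hK)).rexp.sub continuousOn_const)
  intro H hH
  rw [← intervalIntegral.integral_sub (linear_cont H hH) (exp_cont H hH),
    ← intervalIntegral.integral_sub (linear_cont G hG_cont) (exp_cont G hG_cont)]
  refine intervalIntegral.integral_mono_on hT.le ((linear_cont H hH).sub (exp_cont H hH))
    ((linear_cont G hG_cont).sub (exp_cont G hG_cont)) fun s hs => ?_
  exact integral_mul_sub_exp_le_of_tilt hlam_cont (fun p => (hlam_pos p).le) (slice hψ_cont hs)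
    (hψ_nonneg s hs) (slice hψ'_cont hs) (slice hG_cont hs) (slice hH hs) (hG_eq s hs)
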